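/- For every ε > 0 there exists μ > 0 such that for every t ∈ ℕ there exists s ∈ ℕ with the following property: if 𝒜 is an ε-wicked reduced hypergraph with index set I, J ⊆ I has size at least s, and Φ, Ψ, Ω are (μ, 1/3+ε)-holes on J with Φ ≡_{ε,J} Ψ and Ψ ≡_{ε,J} Ω, then there is a subset J⋆ ⊆ J of size at least t such that Φ ≡_{ε,J⋆} Ω. -/

import Mathlib

open Finset Classical

noncomputable section

/-- A reduced hypergraph: a finite (linearly ordered, here `ℕ`) index set `I`,
pairwise disjoint nonempty finite vertex classes `P i j` for distinct `i j ∈ I`,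
and for each triple of distinct indices a tripartite 3-uniform constituent,
encoded by a symmetric edge predicate on vertices. -/
structure ReducedHG where
  I : Finset ℕ
  P : ℕ → ℕ → Finset ℕ
  Psymm : ∀ i j, P i j = P j i
  Pnonempty : ∀ i j, i ∈ I → j ∈ I → i ≠ j → (P i j).Nonempty
  Pdisjoint : ∀ i j k l, i ≠ j → k ≠ l → ({i, j} : Finset ℕ) ≠ ({k, l} : Finset ℕ) →
      Disjoint (P i j) (P k l)
  Edge : ℕ → ℕ → ℕ → Prop
  EdgeSymm : ∀ a b c, Edge a b c → Edge b a c
  EdgeSymm' : ∀ a b c, Edge a b c → Edge a c b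
  EdgeValid : ∀ a b c, Edge a b c → ∃ i j k, i ∈ I ∧ j ∈ I ∧ k ∈ I ∧
      i ≠ j ∧ i ≠ k ∧ j ≠ k ∧ a ∈ P i j ∧ b ∈ P i k ∧ c ∈ P j k

namespace ReducedHG

variable (A : ReducedHG)

/-- The neighbourhood, inside the vertex class `P j k`, of two vertices `a`, `b`. -/
def nbhd (j k : ℕ) (a b : ℕ) : Finset ℕ := (A.P j k).filter fun c => A.Edge a b c

/-- The number of crossing edges between three vertex sets. -/
def ecount (X Y Z : Finset ℕ) : ℕ :=
  ((X ×ˢ Y ×ˢ Z).filter fun t => A.Edge t.1 t.2.1 t.2.2).card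

/-- `(d, ee)`-density: every pair of vertices sharing an index has large degree. -/
def EEDense (d : ℝ) : Prop :=
  ∀ i j k, i ∈ A.I → j ∈ A.I → k ∈ A.I → i ≠ j → i ≠ k → j ≠ k →
    ∀ a ∈ A.P i j, ∀ b ∈ A.P i k,
      d * ((A.P j k).card : ℝ) ≤ ((A.nbhd j k a b).card : ℝ)

/-- `(μ, vvv)`-density: every constituent has many edges. -/
def VVVDense (μ : ℝ) : Prop :=
  ∀ i j k, i ∈ A.I → j ∈ A.I → k ∈ A.I → i ≠ j → i ≠ k → j ≠ k →
    μ * (((A.P i j).card : ℝ) * ((A.P i k).card : ℝ) * ((A.P j k).card : ℝ)) ≤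
      (A.ecount (A.P i j) (A.P i k) (A.P j k) : ℝ)

/-- The reduced hypergraph supports a `K₅⁽³⁾`. -/
def SupportsK5 : Prop :=
  ∃ J ⊆ A.I, J.card = 5 ∧ ∃ f : ℕ → ℕ → ℕ,
    (∀ i ∈ J, ∀ j ∈ J, f i j = f j i) ∧
    (∀ i ∈ J, ∀ j ∈ J, i ≠ j → f i j ∈ A.P i j) ∧
    (∀ i ∈ J, ∀ j ∈ J, ∀ k ∈ J, i ≠ j → i ≠ k → j ≠ k →
      A.Edge (f i j) (f i k) (f j k))

/-- `ε`-wicked: `(1/3 + ε, ee)`-dense and not supporting a `K₅⁽³⁾`. -/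
def Wicked (ε : ℝ) : Prop := A.EEDense (1/3 + ε) ∧ ¬ A.SupportsK5

/-- A `J`-transversal: one vertex in each class `P i j`, `ij ∈ J⁽²⁾`. -/
def IsTransversal (J : Finset ℕ) (Q : ℕ → ℕ → ℕ) : Prop :=
  (∀ i ∈ J, ∀ j ∈ J, Q i j = Q j i) ∧ ∀ i ∈ J, ∀ j ∈ J, i ≠ j → Q i j ∈ A.P i j

/-- A `(K, L)`-transversal: one vertex in each class `P k l`, `(k, l) ∈ K × L`. -/
def IsTransversal2 (K L : Finset ℕ) (Q : ℕ → ℕ → ℕ) : Prop :=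
  ∀ k ∈ K, ∀ l ∈ L, Q k l ∈ A.P k l

/-- An inhabited triple of `J`-transversals. -/
def InhabitedTriple (J : Finset ℕ) (Q R S : ℕ → ℕ → ℕ) : Prop :=
  ∀ i ∈ J, ∀ j ∈ J, ∀ k ∈ J, i < j → j < k → A.Edge (Q i j) (R i k) (S j k)

/-- An inhabited triple consisting of a `(K,L)`-, a `(K,M)`- and an `(L,M)`-transversal. -/
def InhabitedTriple2 (K L M : Finset ℕ) (Q R S : ℕ → ℕ → ℕ) : Prop :=
  ∀ k ∈ K, ∀ l ∈ L, ∀ m ∈ M, A.Edge (Q k l) (R k m) (S l m)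

/-- `Φ` is a `μ`-hole on `J`. -/
def IsHole (μ : ℝ) (J : Finset ℕ) (Φ : Finset ℕ) : Prop :=
  (∀ i ∈ J, ∀ j ∈ J, i ≠ j → (Φ ∩ A.P i j).Nonempty) ∧
  ∀ i ∈ J, ∀ j ∈ J, ∀ k ∈ J, i ≠ j → i ≠ k → j ≠ k →
    (A.ecount (Φ ∩ A.P i j) (Φ ∩ A.P i k) (Φ ∩ A.P j k) : ℝ) ≤
      μ * (((A.P i j).card : ℝ) * ((A.P i k).card : ℝ) * ((A.P j k).card : ℝ))

/-- `Φ` is a `(μ, ϑ)`-hole on `J` (a `μ`-hole of width at least `ϑ`). -/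
def IsHoleW (μ ϑ : ℝ) (J : Finset ℕ) (Φ : Finset ℕ) : Prop :=
  A.IsHole μ J Φ ∧ ∀ i ∈ J, ∀ j ∈ J, i ≠ j →
    ϑ * ((A.P i j).card : ℝ) ≤ (((Φ ∩ A.P i j)).card : ℝ)

/-- Two holes are `ε`-intersecting on `J`. -/
def HolesIntersecting (ε : ℝ) (J : Finset ℕ) (Φ Ψ : Finset ℕ) : Prop :=
  ∀ i ∈ J, ∀ j ∈ J, i ≠ j →
    ε * ((A.P i j).card : ℝ) ≤ ((Φ ∩ Ψ ∩ A.P i j).card : ℝ)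

/-- Two holes are `ε`-disjoint on `J`. -/
def HolesDisjoint (ε : ℝ) (J : Finset ℕ) (Φ Ψ : Finset ℕ) : Prop :=
  ∀ i ∈ J, ∀ j ∈ J, i ≠ j →
    ((Φ ∩ Ψ ∩ A.P i j).card : ℝ) < ε * ((A.P i j).card : ℝ)

/-- The link on `K` of the family `k ↦ f k`, where `f k` is a vertex in a class `P k ·`:
`⋃_{k ≠ k' ∈ K} N(f k, f k')`. -/
def link (K : Finset ℕ) (f : ℕ → ℕ) : Finset ℕ :=
  ((K ×ˢ K).filter fun p => p.1 ≠ p.2).biUnion fun p => A.nbhd p.1 p.2 (f p.1) (f p.2)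

/-- The pair consisting of a transversal `T` on `Sh × B` and a transversal `U` on `Sh × C`
has `δ`-intersecting links. -/
def IntersectingLinks (δ : ℝ) (Sh B C : Finset ℕ) (T U : ℕ → ℕ → ℕ) : Prop :=
  ∀ a ∈ Sh, ∀ a' ∈ Sh, a ≠ a' → ∀ b ∈ B, ∀ c ∈ C,
    δ * ((A.P a a').card : ℝ) ≤
      (((A.nbhd a a' (T a b) (T a' b)) ∩ (A.nbhd a a' (U a c) (U a' c))).card : ℝ)

/-- The pair consisting of a transversal `T` on `Sh × B` and a transversal `U` on `Sh × C`
has `δ`-disjoint links. -/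
def DisjointLinks (δ : ℝ) (Sh B C : Finset ℕ) (T U : ℕ → ℕ → ℕ) : Prop :=
  ∀ a ∈ Sh, ∀ a' ∈ Sh, a ≠ a' → ∀ b ∈ B, ∀ c ∈ C,
    (((A.nbhd a a' (T a b) (T a' b)) ∩ (A.nbhd a a' (U a c) (U a' c))).card : ℝ) <
      δ * ((A.P a a').card : ℝ)

/-- A bicolouring of the reduced hypergraph: both colours appear in every vertex class and
no edge is monochromatic. -/
def IsBicolouring (φ : ℕ → Bool) : Prop :=
  (∀ i ∈ A.I, ∀ j ∈ A.I, i ≠ j →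
    (∃ v ∈ A.P i j, φ v = true) ∧ (∃ v ∈ A.P i j, φ v = false)) ∧
  ∀ a b c, A.Edge a b c → ¬ (φ a = φ b ∧ φ b = φ c)

/-- The minimum monochromatic codegree density is at least `x`: `τ₂(A, φ) ≥ x`. -/
def Tau2Ge (φ : ℕ → Bool) (x : ℝ) : Prop :=
  ∀ i j k, i ∈ A.I → j ∈ A.I → k ∈ A.I → i ≠ j → i ≠ k → j ≠ k →
    ∀ a ∈ A.P i j, ∀ b ∈ A.P i k, φ a = φ b →
      x * ((A.P j k).card : ℝ) ≤ ((A.nbhd j k a b).card : ℝ)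

/-- The `γ`-bad left cherries (both vertices in one hole, many neighbours outside
the other hole). -/
def badLeft (Φ Ψ : Finset ℕ) (γ : ℝ) (i j k : ℕ) : Finset (ℕ × ℕ) :=
  (A.P i j ×ˢ A.P i k).filter fun p =>
    (p.1 ∈ Φ ∧ p.2 ∈ Φ ∧ γ * ((A.P j k).card : ℝ) ≤ (((A.nbhd j k p.1 p.2) \ Ψ).card : ℝ)) ∨
    (p.1 ∈ Ψ ∧ p.2 ∈ Ψ ∧ γ * ((A.P j k).card : ℝ) ≤ (((A.nbhd j k p.1 p.2) \ Φ).card : ℝ))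

/-- The `γ`-bad middle cherries. -/
def badMid (Φ Ψ : Finset ℕ) (γ : ℝ) (i j k : ℕ) : Finset (ℕ × ℕ) :=
  (A.P i j ×ˢ A.P j k).filter fun p =>
    (p.1 ∈ Φ ∧ p.2 ∈ Φ ∧ γ * ((A.P i k).card : ℝ) ≤ (((A.nbhd i k p.1 p.2) \ Ψ).card : ℝ)) ∨
    (p.1 ∈ Ψ ∧ p.2 ∈ Ψ ∧ γ * ((A.P i k).card : ℝ) ≤ (((A.nbhd i k p.1 p.2) \ Φ).card : ℝ))

/-- The `γ`-bad right cherries. -/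
def badRight (Φ Ψ : Finset ℕ) (γ : ℝ) (i j k : ℕ) : Finset (ℕ × ℕ) :=
  (A.P i k ×ˢ A.P j k).filter fun p =>
    (p.1 ∈ Φ ∧ p.2 ∈ Φ ∧ γ * ((A.P i j).card : ℝ) ≤ (((A.nbhd i j p.1 p.2) \ Ψ).card : ℝ)) ∨
    (p.1 ∈ Ψ ∧ p.2 ∈ Ψ ∧ γ * ((A.P i j).card : ℝ) ≤ (((A.nbhd i j p.1 p.2) \ Φ).card : ℝ))

end ReducedHG
namespace ReducedHG

theorem ramsey_aux (a b : ℕ) : ∃ n : ℕ, ∀ (R : ℕ → ℕ → Prop) (_ : ∀ i j, R i j → R j i)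
    (J : Finset ℕ), n ≤ J.card →
    (∃ S ⊆ J, a ≤ S.card ∧ ∀ i ∈ S, ∀ j ∈ S, i ≠ j → R i j) ∨
    (∃ S ⊆ J, b ≤ S.card ∧ ∀ i ∈ S, ∀ j ∈ S, i ≠ j → ¬ R i j) := by
  induction a generalizing b with
  | zero => exact ⟨0, fun R _ J _ => Or.inl ⟨∅, by simp, by simp, by simp⟩⟩
  | succ a iha =>
    induction b with
    | zero => exact ⟨0, fun R _ J _ => Or.inr ⟨∅, by simp, by simp, by simp⟩⟩
    | succ b ihb =>
      obtain ⟨n1, h1⟩ := iha (b + 1)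
      obtain ⟨n2, h2⟩ := ihb
      refine ⟨n1 + n2 + 1, fun R hR J hJ => ?_⟩
      have hne : J.Nonempty := by
        rw [← Finset.card_pos]; omega
      obtain ⟨z, hz⟩ := hne
      have hc : ((J.erase z).filter (fun i => R z i)).card +
          ((J.erase z).filter (fun i => ¬ R z i)).card = J.card - 1 := by
        rw [Finset.card_filter_add_card_filter_not, Finset.card_erase_of_mem hz]
      by_cases hcase : n1 ≤ ((J.erase z).filter (fun i => R z i)).card
      · rcases h1 R hR _ hcase with ⟨S, hS, hSc, hSR⟩ | ⟨S, hS, hSc, hSR⟩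
        · left
          have hzS : z ∉ S := fun h => by simpa using hS h
          refine ⟨insert z S, ?_, ?_, ?_⟩
          · intro w hw
            rcases Finset.mem_insert.1 hw with rfl | hw
            · exact hz
            · have := hS hw
              simp only [Finset.mem_filter, Finset.mem_erase] at this
              exact this.1.2
          · rw [Finset.card_insert_of_notMem hzS]; omega
          · intro i hi j hj hij
            have key : ∀ w ∈ S, R z w := fun w hw => (Finset.mem_filter.1 (hS hw)).2
            rcases Finset.mem_insert.1 hi with hi' | hi' <;>
            rcases Finset.mem_insert.1 hj with hj' | hj'
            · exact absurd (hi'.trans hj'.symm) hij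
            · rw [hi']; exact key _ hj'
            · rw [hj']; exact hR _ _ (key _ hi')
            · exact hSR i hi' j hj' hij
        · right
          refine ⟨S, fun w hw => ?_, hSc, hSR⟩
          have := hS hw
          simp only [Finset.mem_filter, Finset.mem_erase] at this
          exact this.1.2
      · have hcase2 : n2 ≤ ((J.erase z).filter (fun i => ¬ R z i)).card := by omega
        rcases h2 R hR _ hcase2 with ⟨S, hS, hSc, hSR⟩ | ⟨S, hS, hSc, hSR⟩
        · left
          refine ⟨S, fun w hw => ?_, hSc, hSR⟩
          have := hS hw
          simp only [Finset.mem_filter, Finset.mem_erase] at this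
          exact this.1.2
        · right
          have hzS : z ∉ S := fun h => by simpa using hS h
          refine ⟨insert z S, ?_, ?_, ?_⟩
          · intro w hw
            rcases Finset.mem_insert.1 hw with rfl | hw
            · exact hz
            · have := hS hw
              simp only [Finset.mem_filter, Finset.mem_erase] at this
              exact this.1.2
          · rw [Finset.card_insert_of_notMem hzS]; omega
          · intro i hi j hj hij
            have key : ∀ w ∈ S, ¬ R z w := fun w hw => (Finset.mem_filter.1 (hS hw)).2
            rcases Finset.mem_insert.1 hi with hi' | hi' <;>
            rcases Finset.mem_insert.1 hj with hj' | hj'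
            · exact absurd (hi'.trans hj'.symm) hij
            · rw [hi']; exact key _ hj'
            · rw [hj']; exact fun h => key _ hi' (hR _ _ h)
            · exact hSR i hi' j hj' hij

/-- Counting functions in a product with a prescribed pair of coordinates. -/
theorem pi_count {ι : Type} [Fintype ι] (S : ι → Finset ℕ)
    (e e' : ι) (hne : e ≠ e') (B : Finset (ℕ × ℕ)) (hB : B ⊆ S e ×ˢ S e') :
    ((Fintype.piFinset S).filter (fun f => (f e, f e') ∈ B)).card * ((S e).card * (S e').card)
      = B.card * (Fintype.piFinset S).card := by
  have h1 : ((Fintype.piFinset S).filter (fun f => (f e, f e') ∈ B)) =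
      B.biUnion (fun p => Fintype.piFinset
        (Function.update (Function.update S e {p.1}) e' {p.2})) := by
    ext f
    simp only [Finset.mem_filter, Fintype.mem_piFinset, Finset.mem_biUnion]
    constructor
    · rintro ⟨hf, hb⟩
      refine ⟨_, hb, fun a => ?_⟩
      by_cases ha' : a = e'
      · subst ha'; simp
      · rw [Function.update_of_ne ha']
        by_cases ha : a = e
        · subst ha; simp
        · rw [Function.update_of_ne ha]; exact hf a
    · rintro ⟨p, hp, hf⟩
      have he' : f e' = p.2 := by simpa using hf e'
      have he : f e = p.1 := by simpa [Function.update_of_ne hne] using hf e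
      have hpp := Finset.mem_product.1 (hB hp)
      refine ⟨fun a => ?_, by rw [he, he']; exact hp⟩
      by_cases ha' : a = e'
      · subst ha'; rw [he']; exact hpp.2
      · by_cases ha : a = e
        · subst ha; rw [he]; exact hpp.1
        · have := hf a
          rwa [Function.update_of_ne ha', Function.update_of_ne ha] at this
  have h2 : ∀ p ∈ B, (Fintype.piFinset
        (Function.update (Function.update S e {p.1}) e' {p.2})).card
        = ∏ a ∈ (Finset.univ.erase e).erase e', (S a).card := by
    intro p _
    rw [Fintype.card_piFinset, ← Finset.mul_prod_erase _ _ (Finset.mem_univ e),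
      ← Finset.mul_prod_erase (Finset.univ.erase e) _
        (Finset.mem_erase.2 ⟨hne.symm, Finset.mem_univ e'⟩)]
    rw [Function.update_of_ne hne]
    simp only [Function.update_self, Finset.card_singleton, one_mul]
    refine Finset.prod_congr rfl fun a ha => ?_
    have := Finset.mem_erase.1 ha
    have h3 := Finset.mem_erase.1 this.2
    rw [Function.update_of_ne this.1, Function.update_of_ne h3.1]
  rw [h1, Finset.card_biUnion, Finset.sum_congr rfl h2, Finset.sum_const, smul_eq_mul,
    Fintype.card_piFinset, ← Finset.mul_prod_erase _ _ (Finset.mem_univ e),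
      ← Finset.mul_prod_erase (Finset.univ.erase e) _
        (Finset.mem_erase.2 ⟨hne.symm, Finset.mem_univ e'⟩)]
  · ring
  · intro p _ q _ hpq
    rw [Function.onFun, Finset.disjoint_left]
    intro f hf hg
    rw [Fintype.mem_piFinset] at hf hg
    apply hpq
    have a1 : f e' = p.2 := by simpa using hf e'
    have a2 : f e = p.1 := by simpa [Function.update_of_ne hne] using hf e
    have b1 : f e' = q.2 := by simpa using hg e'
    have b2 : f e = q.1 := by simpa [Function.update_of_ne hne] using hg e
    exact Prod.ext (a2.symm.trans b2) (a1.symm.trans b1)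

theorem select_fin {ι : Type} [Fintype ι] (S : ι → Finset ℕ) (hS : ∀ e, (S e).Nonempty)
    (Bad : ι → ι → ℕ → ℕ → Prop) (δ : ℝ)
    (hδ : δ * (Fintype.card ι : ℝ) ^ 2 < 1) (hδ0 : 0 ≤ δ)
    (hBad : ∀ e e', e ≠ e' →
      ((((S e ×ˢ S e').filter (fun p => Bad e e' p.1 p.2)).card : ℝ) ≤
        δ * ((S e).card * (S e').card))) :
    ∃ f : ι → ℕ, (∀ e, f e ∈ S e) ∧ ∀ e e', e ≠ e' → ¬ Bad e e' (f e) (f e') := by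
  by_contra hcon
  push Not at hcon
  have hsub : Fintype.piFinset S ⊆ (Finset.univ.filter (fun p : ι × ι => p.1 ≠ p.2)).biUnion
      (fun p => (Fintype.piFinset S).filter (fun f => (f p.1, f p.2) ∈
        ((S p.1 ×ˢ S p.2).filter (fun q => Bad p.1 p.2 q.1 q.2)))) := by
    intro f hf
    have hf' := Fintype.mem_piFinset.1 hf
    obtain ⟨e, e', hne, hb⟩ := hcon f hf'
    refine Finset.mem_biUnion.2 ⟨(e, e'), by simpa using hne, ?_⟩
    refine Finset.mem_filter.2 ⟨hf, ?_⟩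
    simp [hf' e, hf' e', hb]
  have hpos : 0 < ((Fintype.piFinset S).card : ℝ) := by
    exact_mod_cast Finset.card_pos.2 (Fintype.piFinset_nonempty.2 hS)
  have h1 : ((Fintype.piFinset S).card : ℝ) ≤
      ∑ p ∈ (Finset.univ.filter (fun p : ι × ι => p.1 ≠ p.2)),
        δ * ((Fintype.piFinset S).card : ℝ) := by
    refine le_trans (Nat.cast_le.2 ((Finset.card_le_card hsub).trans Finset.card_biUnion_le)) ?_
    push_cast
    refine Finset.sum_le_sum fun p hp => ?_
    have hne : p.1 ≠ p.2 := (Finset.mem_filter.1 hp).2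
    have hc := pi_count S p.1 p.2 hne
      ((S p.1 ×ˢ S p.2).filter (fun q => Bad p.1 p.2 q.1 q.2)) (Finset.filter_subset _ _)
    have hb := hBad p.1 p.2 hne
    have p1 : 0 < ((S p.1).card : ℝ) := by exact_mod_cast Finset.card_pos.2 (hS _)
    have p2 : 0 < ((S p.2).card : ℝ) := by exact_mod_cast Finset.card_pos.2 (hS _)
    have hc' := congrArg (Nat.cast : ℕ → ℝ) hc
    push_cast at hc'
    refine le_of_mul_le_mul_right ?_ (mul_pos p1 p2)
    rw [hc']
    nlinarith
  rw [Finset.sum_const, nsmul_eq_mul] at h1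
  have h2 : ((Finset.univ.filter (fun p : ι × ι => p.1 ≠ p.2)).card : ℝ) ≤
      (Fintype.card ι : ℝ) ^ 2 := by
    have := Finset.card_filter_le (Finset.univ : Finset (ι × ι)) (fun p => p.1 ≠ p.2)
    rw [Finset.card_univ, Fintype.card_prod] at this
    calc _ ≤ ((Fintype.card ι * Fintype.card ι : ℕ) : ℝ) := by exact_mod_cast this
      _ = _ := by push_cast; ring
  have h3 := mul_le_mul_of_nonneg_right h2 (mul_nonneg hδ0 hpos.le)
  nlinarith

theorem select (E : Finset (ℕ × ℕ)) (S : ℕ × ℕ → Finset ℕ) (hS : ∀ e ∈ E, (S e).Nonempty)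
    (Bad : ℕ × ℕ → ℕ × ℕ → ℕ → ℕ → Prop) (δ : ℝ)
    (hδ : δ * (E.card : ℝ) ^ 2 < 1) (hδ0 : 0 ≤ δ)
    (hBad : ∀ e ∈ E, ∀ e' ∈ E, e ≠ e' →
      ((((S e ×ˢ S e').filter (fun p => Bad e e' p.1 p.2)).card : ℝ) ≤
        δ * ((S e).card * (S e').card))) :
    ∃ f : ℕ × ℕ → ℕ, (∀ e ∈ E, f e ∈ S e) ∧
      ∀ e ∈ E, ∀ e' ∈ E, e ≠ e' → ¬ Bad e e' (f e) (f e') := by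
  obtain ⟨f, hf, hb⟩ := select_fin (ι := {e // e ∈ E}) (fun e => S e.1) (fun e => hS _ e.2)
    (fun e e' => Bad e.1 e'.1) δ (by simpa using hδ) hδ0
    (fun e e' hne => hBad _ e.2 _ e'.2 (fun h => hne (Subtype.ext h)))
  refine ⟨fun e => if h : e ∈ E then f ⟨e, h⟩ else 0, fun e he => ?_, fun e he e' he' hne => ?_⟩
  · simpa [he] using hf ⟨e, he⟩
  · simpa [he, he'] using hb ⟨e, he⟩ ⟨e', he'⟩ (fun h => hne (congrArg Subtype.val h))

theorem popular (ε : ℝ) (P : Finset ℕ) (hP : P.Nonempty) (N : ℕ → Finset ℕ)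
    (Y1 Y2 : Finset ℕ) (h1 : Y1.Nonempty) (h2 : Y2.Nonempty)
    (hsub : ∀ y ∈ Y1, N y ⊆ P)
    (h : ∀ y ∈ Y1, ∀ z ∈ Y2, ε * (P.card : ℝ) ≤ ((N y ∩ N z).card : ℝ)) :
    ∃ v ∈ P, ε * (Y1.card : ℝ) ≤ ((Y1.filter (fun y => v ∈ N y)).card : ℝ) ∧
      ε * (Y2.card : ℝ) ≤ ((Y2.filter (fun y => v ∈ N y)).card : ℝ) := by
  have p1 : 0 < (Y1.card : ℝ) := by exact_mod_cast Finset.card_pos.2 h1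
  have p2 : 0 < (Y2.card : ℝ) := by exact_mod_cast Finset.card_pos.2 h2
  have key : ∑ v ∈ P, (ε * (Y1.card * Y2.card) : ℝ) ≤
      ∑ v ∈ P, (((Y1.filter (fun y => v ∈ N y)).card : ℝ) *
        ((Y2.filter (fun y => v ∈ N y)).card : ℝ)) := by
    have e1 : ∑ v ∈ P, (((Y1.filter (fun y => v ∈ N y)).card : ℝ) *
        ((Y2.filter (fun y => v ∈ N y)).card : ℝ)) =
        ∑ y ∈ Y1, ∑ z ∈ Y2, ((N y ∩ N z).card : ℝ) := by
      have : ∀ y ∈ Y1, ∀ z ∈ Y2, ((N y ∩ N z).card : ℝ) =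
          ∑ v ∈ P, (if v ∈ N y then (1 : ℝ) else 0) * (if v ∈ N z then (1 : ℝ) else 0) := by
        intro y hy z _
        have : N y ∩ N z = P.filter (fun v => v ∈ N y ∧ v ∈ N z) := by
          ext v; simp only [Finset.mem_inter, Finset.mem_filter]
          exact ⟨fun h => ⟨hsub y hy h.1, h⟩, fun h => h.2⟩
        rw [this, Finset.card_filter]
        push_cast
        refine Finset.sum_congr rfl fun v _ => ?_
        by_cases a : v ∈ N y <;> by_cases b : v ∈ N z <;> simp [a, b]
      rw [Finset.sum_congr rfl fun y hy => Finset.sum_congr rfl fun z hz => this y hy z hz]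
      rw [Finset.sum_congr rfl fun y _ => Finset.sum_comm, Finset.sum_comm]
      refine Finset.sum_congr rfl fun v _ => ?_
      rw [Finset.card_filter, Finset.card_filter]
      push_cast
      rw [Finset.sum_mul_sum]
    rw [e1, Finset.sum_const, nsmul_eq_mul]
    calc (P.card : ℝ) * (ε * (Y1.card * Y2.card)) = ∑ y ∈ Y1, ∑ z ∈ Y2, ε * (P.card : ℝ) := by
          simp only [Finset.sum_const, nsmul_eq_mul]; ring
      _ ≤ _ := Finset.sum_le_sum fun y hy => Finset.sum_le_sum fun z hz => h y hy z hz
  obtain ⟨v, hv, hle⟩ := Finset.exists_le_of_sum_le hP key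
  have c1 : ((Y1.filter (fun y => v ∈ N y)).card : ℝ) ≤ Y1.card := by
    exact_mod_cast Finset.card_filter_le _ _
  have c2 : ((Y2.filter (fun y => v ∈ N y)).card : ℝ) ≤ Y2.card := by
    exact_mod_cast Finset.card_filter_le _ _
  have n1 : 0 ≤ ((Y1.filter (fun y => v ∈ N y)).card : ℝ) := Nat.cast_nonneg _
  have n2 : 0 ≤ ((Y2.filter (fun y => v ∈ N y)).card : ℝ) := Nat.cast_nonneg _
  refine ⟨v, hv, ?_, ?_⟩
  · refine le_of_mul_le_mul_right ?_ p2
    nlinarith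
  · refine le_of_mul_le_mul_right ?_ p1
    nlinarith

theorem popular_iter (ε : ℝ) (hε : 0 < ε) (P : ℕ × ℕ → Finset ℕ) (N : ℕ × ℕ → ℕ → Finset ℕ)
    (Y1 Y2 : Finset ℕ) (h1 : Y1.Nonempty) (h2 : Y2.Nonempty) (S : Finset (ℕ × ℕ))
    (hP : ∀ s ∈ S, (P s).Nonempty)
    (hsub : ∀ s ∈ S, ∀ y ∈ Y1, N s y ⊆ P s)
    (h : ∀ s ∈ S, ∀ y ∈ Y1, ∀ z ∈ Y2, ε * ((P s).card : ℝ) ≤ ((N s y ∩ N s z).card : ℝ)) :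
    ∃ Z1 ⊆ Y1, ∃ Z2 ⊆ Y2, ε ^ S.card * (Y1.card : ℝ) ≤ Z1.card ∧
      ε ^ S.card * (Y2.card : ℝ) ≤ Z2.card ∧
      ∃ v : ℕ × ℕ → ℕ, ∀ s ∈ S, v s ∈ P s ∧ ∀ y ∈ Z1 ∪ Z2, v s ∈ N s y := by
  induction S using Finset.induction_on with
  | empty => exact ⟨Y1, subset_rfl, Y2, subset_rfl, by simp, by simp, fun _ => 0, by simp⟩
  | insert s S hs ih =>
    obtain ⟨Z1, hZ1, Z2, hZ2, c1, c2, v, hv⟩ := ih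
      (fun r hr => hP r (Finset.mem_insert_of_mem hr))
      (fun r hr => hsub r (Finset.mem_insert_of_mem hr))
      (fun r hr => h r (Finset.mem_insert_of_mem hr))
    have p1 : 0 < (Y1.card : ℝ) := by exact_mod_cast Finset.card_pos.2 h1
    have p2 : 0 < (Y2.card : ℝ) := by exact_mod_cast Finset.card_pos.2 h2
    have q1 : 0 < (Z1.card : ℝ) := lt_of_lt_of_le (by positivity) c1
    have q2 : 0 < (Z2.card : ℝ) := lt_of_lt_of_le (by positivity) c2
    have hsS := Finset.mem_insert_self s S
    obtain ⟨w, hw, d1, d2⟩ := popular ε (P s) (hP s hsS) (N s) Z1 Z2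
      (Finset.card_pos.1 (by exact_mod_cast q1)) (Finset.card_pos.1 (by exact_mod_cast q2))
      (fun y hy => hsub s hsS y (hZ1 hy)) (fun y hy z hz => h s hsS y (hZ1 hy) z (hZ2 hz))
    refine ⟨Z1.filter (fun y => w ∈ N s y), (Finset.filter_subset _ _).trans hZ1,
      Z2.filter (fun y => w ∈ N s y), (Finset.filter_subset _ _).trans hZ2, ?_, ?_,
      Function.update v s w, ?_⟩
    · rw [Finset.card_insert_of_notMem hs, pow_succ]; nlinarith
    · rw [Finset.card_insert_of_notMem hs, pow_succ]; nlinarith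
    · intro r hr
      by_cases hrs : r = s
      · subst hrs
        rw [Function.update_self]
        refine ⟨hw, fun y hy => ?_⟩
        rcases Finset.mem_union.1 hy with hy | hy <;> exact (Finset.mem_filter.1 hy).2
      · rw [Function.update_of_ne hrs]
        have hrS : r ∈ S := (Finset.mem_insert.1 hr).resolve_left hrs
        refine ⟨(hv r hrS).1, fun y hy => (hv r hrS).2 y ?_⟩
        rcases Finset.mem_union.1 hy with hy | hy
        · exact Finset.mem_union_left _ (Finset.mem_filter.1 hy).1
        · exact Finset.mem_union_right _ (Finset.mem_filter.1 hy).1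

variable (A : ReducedHG)

theorem ecount_eq (X Y Z : Finset ℕ) : (A.ecount X Y Z : ℝ) =
    ∑ p ∈ X ×ˢ Y, ((Z.filter (fun c => A.Edge p.1 p.2 c)).card : ℝ) := by
  rw [ecount, Finset.card_filter, Finset.sum_product, Finset.sum_product]
  push_cast
  refine Finset.sum_congr rfl fun x _ => ?_
  rw [Finset.sum_product]
  refine Finset.sum_congr rfl fun y _ => ?_
  rw [Finset.card_filter]
  push_cast
  rfl

/-- few bad cherries in a hole -/
theorem bad_cherries (ε μ : ℝ) (hε : 0 < ε) (hμ : 0 < μ) (H : Finset ℕ) (i j k : ℕ)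
    (hp : (A.P j k).Nonempty)
    (hH : (A.ecount (H ∩ A.P i j) (H ∩ A.P i k) (H ∩ A.P j k) : ℝ) ≤
      μ * (((A.P i j).card : ℝ) * ((A.P i k).card : ℝ) * ((A.P j k).card : ℝ)))
    (U V : Finset ℕ) (hU : U ⊆ H ∩ A.P i j) (hV : V ⊆ H ∩ A.P i k)
    (cU : ε * ((A.P i j).card : ℝ) ≤ U.card) (cV : ε * ((A.P i k).card : ℝ) ≤ V.card)
    (B : ℕ × ℕ → Prop)
    (hB : ∀ p, B p → ε * ((A.P j k).card : ℝ) < (((A.nbhd j k p.1 p.2) ∩ H).card : ℝ)) :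
    (((U ×ˢ V).filter B).card : ℝ) ≤ μ / ε ^ 3 * (U.card * V.card) := by
  have pp : 0 < ((A.P j k).card : ℝ) := by exact_mod_cast Finset.card_pos.2 hp
  have h1 : (((U ×ˢ V).filter B).card : ℝ) * (ε * (A.P j k).card) ≤
      μ * (((A.P i j).card : ℝ) * ((A.P i k).card : ℝ) * ((A.P j k).card : ℝ)) := by
    refine le_trans ?_ hH
    rw [ecount_eq, ← nsmul_eq_mul, ← Finset.sum_const]
    calc _ ≤ ∑ p ∈ (U ×ˢ V).filter B,
          (((H ∩ A.P j k).filter (fun c => A.Edge p.1 p.2 c)).card : ℝ) := by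
          refine Finset.sum_le_sum fun p hp => ?_
          have := (hB p (Finset.mem_filter.1 hp).2).le
          refine this.trans (le_of_eq ?_)
          congr 2
          ext c; simp only [nbhd, Finset.mem_inter, Finset.mem_filter]; tauto
      _ ≤ _ := by
          refine Finset.sum_le_sum_of_subset_of_nonneg ?_ (fun _ _ _ => Nat.cast_nonneg _)
          exact (Finset.filter_subset _ _).trans (Finset.product_subset_product hU hV)
  have h2 : (((U ×ˢ V).filter B).card : ℝ) * ε ≤
      μ * (((A.P i j).card : ℝ) * ((A.P i k).card : ℝ)) := by
    refine le_of_mul_le_mul_right ?_ pp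
    linarith
  have h3 : (ε * ((A.P i j).card : ℝ)) * (ε * ((A.P i k).card : ℝ)) ≤ U.card * V.card :=
    mul_le_mul cU cV (by positivity) (by positivity)
  rw [div_mul_eq_mul_div, le_div_iff₀ (by positivity)]
  have h4 := mul_le_mul_of_nonneg_right h2 (sq_nonneg ε)
  have h5 := mul_le_mul_of_nonneg_left h3 hμ.le
  nlinarith

/-- many edges inside a link -/
theorem link_edges (ε μ : ℝ) (hε : 0 < ε) (H : Finset ℕ) (i j k : ℕ)
    (hH : (A.ecount (H ∩ A.P i j) (H ∩ A.P i k) (H ∩ A.P j k) : ℝ) ≤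
      μ * (((A.P i j).card : ℝ) * ((A.P i k).card : ℝ) * ((A.P j k).card : ℝ)))
    (hW : (1/3 + ε) * ((A.P j k).card : ℝ) ≤ ((H ∩ A.P j k).card : ℝ))
    (hd : ∀ a ∈ A.P i j, ∀ b ∈ A.P i k,
      (1/3 + ε) * ((A.P j k).card : ℝ) ≤ ((A.nbhd j k a b).card : ℝ))
    (Nij Nik Njk : Finset ℕ) (sij : Nij ⊆ A.P i j) (sik : Nik ⊆ A.P i k) (sjk : Njk ⊆ A.P j k)
    (cij : ε * ((A.P i j).card : ℝ) ≤ ((Nij ∩ H).card : ℝ))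
    (cik : ε * ((A.P i k).card : ℝ) ≤ ((Nik ∩ H).card : ℝ))
    (cjk : (1/3 + ε) * ((A.P j k).card : ℝ) ≤ (Njk.card : ℝ))
    (djk : ((Njk ∩ H).card : ℝ) ≤ ε * ((A.P j k).card : ℝ)) :
    (2 * ε ^ 3 - μ) * (((A.P i j).card : ℝ) * ((A.P i k).card : ℝ) * ((A.P j k).card : ℝ)) ≤
      A.ecount Nij Nik Njk := by
  set p := ((A.P j k).card : ℝ) with hpdef
  have hp0 : 0 ≤ p := Nat.cast_nonneg _
  have hun : (2/3 + ε) * p ≤ ((Njk ∪ (H ∩ A.P j k)).card : ℝ) := by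
    have h1 := Finset.card_union_add_card_inter Njk (H ∩ A.P j k)
    have h2 : Njk ∩ (H ∩ A.P j k) = Njk ∩ H := by
      ext c; simp only [Finset.mem_inter]
      exact ⟨fun h => ⟨h.1, h.2.1⟩, fun h => ⟨h.1, h.2, sjk h.1⟩⟩
    rw [h2] at h1
    have h3 : ((Njk ∪ (H ∩ A.P j k)).card : ℝ) + ((Njk ∩ H).card : ℝ) =
      (Njk.card : ℝ) + ((H ∩ A.P j k).card : ℝ) := by exact_mod_cast h1
    nlinarith
  have hpt : ∀ q ∈ (Nij ∩ H) ×ˢ (Nik ∩ H), 2 * ε * p ≤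
      ((Njk.filter (fun c => A.Edge q.1 q.2 c)).card : ℝ) +
      (((H ∩ A.P j k).filter (fun c => A.Edge q.1 q.2 c)).card : ℝ) := by
    intro q hq
    simp only [Finset.mem_product, Finset.mem_inter] at hq
    have hn := hd q.1 (sij hq.1.1) q.2 (sik hq.2.1)
    have h1 := Finset.card_union_add_card_inter (A.nbhd j k q.1 q.2) (Njk ∪ (H ∩ A.P j k))
    have h2 : ((A.nbhd j k q.1 q.2) ∪ (Njk ∪ (H ∩ A.P j k))).card ≤ (A.P j k).card := by
      refine Finset.card_le_card ?_
      refine Finset.union_subset (Finset.filter_subset _ _)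
        (Finset.union_subset sjk Finset.inter_subset_right)
    have h3 : ((A.nbhd j k q.1 q.2) ∩ (Njk ∪ (H ∩ A.P j k))).card ≤
        (Njk.filter (fun c => A.Edge q.1 q.2 c)).card +
        ((H ∩ A.P j k).filter (fun c => A.Edge q.1 q.2 c)).card := by
      refine le_trans (Finset.card_le_card ?_) (Finset.card_union_le _ _)
      intro c hc
      simp only [nbhd, Finset.mem_inter, Finset.mem_union, Finset.mem_filter] at hc ⊢
      tauto
    have h1' : (((A.nbhd j k q.1 q.2) ∪ (Njk ∪ (H ∩ A.P j k))).card : ℝ) +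
        (((A.nbhd j k q.1 q.2) ∩ (Njk ∪ (H ∩ A.P j k))).card : ℝ) =
        ((A.nbhd j k q.1 q.2).card : ℝ) + ((Njk ∪ (H ∩ A.P j k)).card : ℝ) := by
      exact_mod_cast h1
    have h2' : (((A.nbhd j k q.1 q.2) ∪ (Njk ∪ (H ∩ A.P j k))).card : ℝ) ≤ p := by
      rw [hpdef]; exact_mod_cast h2
    have h3' : (((A.nbhd j k q.1 q.2) ∩ (Njk ∪ (H ∩ A.P j k))).card : ℝ) ≤
        ((Njk.filter (fun c => A.Edge q.1 q.2 c)).card : ℝ) +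
        (((H ∩ A.P j k).filter (fun c => A.Edge q.1 q.2 c)).card : ℝ) := by
      exact_mod_cast h3
    nlinarith
  have hsum := Finset.sum_le_sum hpt
  rw [Finset.sum_const, nsmul_eq_mul, Finset.card_product, Finset.sum_add_distrib] at hsum
  have e1 : ∑ q ∈ (Nij ∩ H) ×ˢ (Nik ∩ H), ((Njk.filter (fun c => A.Edge q.1 q.2 c)).card : ℝ)
      ≤ A.ecount Nij Nik Njk := by
    rw [ecount_eq]
    exact Finset.sum_le_sum_of_subset_of_nonneg
      (Finset.product_subset_product Finset.inter_subset_left Finset.inter_subset_left)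
      (fun _ _ _ => Nat.cast_nonneg _)
  have e2 : ∑ q ∈ (Nij ∩ H) ×ˢ (Nik ∩ H),
      (((H ∩ A.P j k).filter (fun c => A.Edge q.1 q.2 c)).card : ℝ)
      ≤ A.ecount (H ∩ A.P i j) (H ∩ A.P i k) (H ∩ A.P j k) := by
    rw [ecount_eq]
    refine Finset.sum_le_sum_of_subset_of_nonneg
      (Finset.product_subset_product ?_ ?_)
      (fun _ _ _ => Nat.cast_nonneg _)
    · intro c hc; simp only [Finset.mem_inter] at hc ⊢; exact ⟨hc.2, sij hc.1⟩
    · intro c hc; simp only [Finset.mem_inter] at hc ⊢; exact ⟨hc.2, sik hc.1⟩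
  have h3 : (ε * ((A.P i j).card : ℝ)) * (ε * ((A.P i k).card : ℝ)) ≤
      ((Nij ∩ H).card : ℝ) * ((Nik ∩ H).card : ℝ) :=
    mul_le_mul cij cik (by positivity) (by positivity)
  have h4 := mul_le_mul_of_nonneg_right h3 (by positivity : 0 ≤ 2 * ε * p)
  push_cast at hsum
  nlinarith

theorem K5_of (a b c d e : ℕ) (hI : ({a, b, c, d, e} : Finset ℕ) ⊆ A.I)
    (hcard : ({a, b, c, d, e} : Finset ℕ).card = 5) (f : ℕ → ℕ → ℕ)
    (hf : ∀ i j, f i j = f j i)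
    (hab : f a b ∈ A.P a b) (hac : f a c ∈ A.P a c) (had : f a d ∈ A.P a d)
    (hae : f a e ∈ A.P a e) (hbc : f b c ∈ A.P b c) (hbd : f b d ∈ A.P b d)
    (hbe : f b e ∈ A.P b e) (hcd : f c d ∈ A.P c d) (hce : f c e ∈ A.P c e)
    (hde : f d e ∈ A.P d e)
    (h1 : A.Edge (f a b) (f a c) (f b c)) (h2 : A.Edge (f a b) (f a d) (f b d))
    (h3 : A.Edge (f a b) (f a e) (f b e)) (h4 : A.Edge (f a c) (f a d) (f c d))
    (h5 : A.Edge (f a c) (f a e) (f c e)) (h6 : A.Edge (f a d) (f a e) (f d e))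
    (h7 : A.Edge (f b c) (f b d) (f c d)) (h8 : A.Edge (f b c) (f b e) (f c e))
    (h9 : A.Edge (f b d) (f b e) (f d e)) (h10 : A.Edge (f c d) (f c e) (f d e)) :
    A.SupportsK5 := by
  refine ⟨{a, b, c, d, e}, hI, hcard, f, fun i _ j _ => hf i j, ?_, ?_⟩
  · have sw : ∀ i j, f i j ∈ A.P i j → f j i ∈ A.P j i := fun i j h => by
      rw [hf, A.Psymm]; exact h
    intro i hi j hj hij
    simp only [Finset.mem_insert, Finset.mem_singleton] at hi hj
    rcases hi with rfl | rfl | rfl | rfl | rfl <;> rcases hj with rfl | rfl | rfl | rfl | rfl <;>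
    first
    | exact absurd rfl hij
    | assumption
    | (apply sw; assumption)
  · set T : ℕ → ℕ → ℕ → Prop := fun i j k => A.Edge (f i j) (f i k) (f j k) with hT
    have s1 : ∀ i j k, T i j k → T j i k := fun i j k h => by
      have := A.EdgeSymm' _ _ _ h
      simp only [hT]; rw [hf j i]; exact this
    have s2 : ∀ i j k, T i j k → T i k j := fun i j k h => by
      have := A.EdgeSymm _ _ _ h
      simp only [hT]; rw [hf k j]; exact this
    have g1 : T a b c := h1
    have g2 : T a b d := h2
    have g3 : T a b e := h3
    have g4 : T a c d := h4
    have g5 : T a c e := h5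
    have g6 : T a d e := h6
    have g7 : T b c d := h7
    have g8 : T b c e := h8
    have g9 : T b d e := h9
    have g10 : T c d e := h10
    clear h1 h2 h3 h4 h5 h6 h7 h8 h9 h10
    intro i hi j hj k hk hij hik hjk
    change T i j k
    clear_value T
    clear hab hac had hae hbc hbd hbe hcd hce hde hI hcard hT
    simp only [Finset.mem_insert, Finset.mem_singleton] at hi hj hk
    rcases hi with rfl | rfl | rfl | rfl | rfl <;> rcases hj with rfl | rfl | rfl | rfl | rfl <;>
    first
    | exact absurd rfl hij
    | (rcases hk with rfl | rfl | rfl | rfl | rfl <;>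
      first
      | exact absurd rfl hik
      | exact absurd rfl hjk
      | assumption
      | (apply s1; assumption)
      | (apply s2; assumption)
      | (apply s1; apply s2; assumption)
      | (apply s2; apply s1; assumption)
      | (apply s1; apply s2; apply s1; assumption))

theorem K5_of_values (a b c d e : ℕ) (ha : a ∈ A.I) (hb : b ∈ A.I) (hc : c ∈ A.I)
    (hd : d ∈ A.I) (he : e ∈ A.I)
    (ab : a ≠ b) (ac : a ≠ c) (ad : a ≠ d) (ae : a ≠ e) (bc : b ≠ c) (bd : b ≠ d) (be : b ≠ e)
    (cd : c ≠ d) (ce : c ≠ e) (de : d ≠ e)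
    (vab vac vad vae vbc vbd vbe vcd vce vde : ℕ)
    (hab : vab ∈ A.P a b) (hac : vac ∈ A.P a c) (had : vad ∈ A.P a d)
    (hae : vae ∈ A.P a e) (hbc : vbc ∈ A.P b c) (hbd : vbd ∈ A.P b d)
    (hbe : vbe ∈ A.P b e) (hcd : vcd ∈ A.P c d) (hce : vce ∈ A.P c e)
    (hde : vde ∈ A.P d e)
    (h1 : A.Edge vab vac vbc) (h2 : A.Edge vab vad vbd)
    (h3 : A.Edge vab vae vbe) (h4 : A.Edge vac vad vcd)
    (h5 : A.Edge vac vae vce) (h6 : A.Edge vad vae vde)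
    (h7 : A.Edge vbc vbd vcd) (h8 : A.Edge vbc vbe vce)
    (h9 : A.Edge vbd vbe vde) (h10 : A.Edge vcd vce vde) :
    A.SupportsK5 := by
  have := ab.symm
  have := ac.symm
  have := ad.symm
  have := ae.symm
  have := bc.symm
  have := bd.symm
  have := be.symm
  have := cd.symm
  have := ce.symm
  have := de.symm
  set F : Sym2 ℕ → ℕ := fun z =>
    if z = s(a, b) then vab else if z = s(a, c) then vac else if z = s(a, d) then vad else
    if z = s(a, e) then vae else if z = s(b, c) then vbc else if z = s(b, d) then vbd else
    if z = s(b, e) then vbe else if z = s(c, d) then vcd else if z = s(c, e) then vce else vde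
    with hF
  have e1 : F s(a, b) = vab := by simp [hF]
  have e2 : F s(a, c) = vac := by simp [F, *]
  have e3 : F s(a, d) = vad := by simp [F, *]
  have e4 : F s(a, e) = vae := by simp [F, *]
  have e5 : F s(b, c) = vbc := by simp [F, *]
  have e6 : F s(b, d) = vbd := by simp [F, *]
  have e7 : F s(b, e) = vbe := by simp [F, *]
  have e8 : F s(c, d) = vcd := by simp [F, *]
  have e9 : F s(c, e) = vce := by simp [F, *]
  have e10 : F s(d, e) = vde := by simp [F, *]
  clear_value F
  refine A.K5_of a b c d e ?_ ?_ (fun i j => F s(i, j)) (fun i j => by simp only [Sym2.eq_swap])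
    ?_ ?_ ?_ ?_ ?_ ?_ ?_ ?_ ?_ ?_ ?_ ?_ ?_ ?_ ?_ ?_ ?_ ?_ ?_ ?_
  · intro z hz
    simp only [Finset.mem_insert, Finset.mem_singleton] at hz
    rcases hz with rfl | rfl | rfl | rfl | rfl <;> assumption
  · simp [Finset.card_insert_of_notMem, *]
  all_goals simp only [e1, e2, e3, e4, e5, e6, e7, e8, e9, e10]
  all_goals assumption

theorem nbhd_symm (j k a b : ℕ) : A.nbhd j k a b = A.nbhd k j b a := by
  ext c
  simp only [nbhd, Finset.mem_filter, A.Psymm j k]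
  exact ⟨fun h => ⟨h.1, A.EdgeSymm _ _ _ h.2⟩, fun h => ⟨h.1, A.EdgeSymm _ _ _ h.2⟩⟩

theorem mixed (ε : ℝ) (P Φ Ω N : Finset ℕ) (hN : N ⊆ P)
    (cN : (1/3 + ε) * (P.card : ℝ) ≤ N.card)
    (cΦ : (1/3 + ε) * (P.card : ℝ) ≤ ((Φ ∩ P).card : ℝ))
    (cΩ : (1/3 + ε) * (P.card : ℝ) ≤ ((Ω ∩ P).card : ℝ))
    (hd : ((Φ ∩ Ω ∩ P).card : ℝ) ≤ ε * P.card) :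
    ε * (P.card : ℝ) ≤ ((N ∩ Φ).card : ℝ) ∨ ε * (P.card : ℝ) ≤ ((N ∩ Ω).card : ℝ) := by
  have h1 := Finset.card_union_add_card_inter (Φ ∩ P) (Ω ∩ P)
  have h1e : (Φ ∩ P) ∩ (Ω ∩ P) = Φ ∩ Ω ∩ P := by
    ext c; simp only [Finset.mem_inter]; tauto
  rw [h1e] at h1
  have h2 := Finset.card_union_add_card_inter N ((Φ ∩ P) ∪ (Ω ∩ P))
  have h3 : (N ∪ ((Φ ∩ P) ∪ (Ω ∩ P))).card ≤ P.card :=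
    Finset.card_le_card (Finset.union_subset hN
      (Finset.union_subset Finset.inter_subset_right Finset.inter_subset_right))
  have h4 : (N ∩ ((Φ ∩ P) ∪ (Ω ∩ P))).card ≤ (N ∩ Φ).card + (N ∩ Ω).card := by
    refine le_trans (Finset.card_le_card ?_) (Finset.card_union_le _ _)
    intro c hc
    simp only [Finset.mem_inter, Finset.mem_union] at hc ⊢
    tauto
  have h1' := congrArg (Nat.cast : ℕ → ℝ) h1
  have h2' := congrArg (Nat.cast : ℕ → ℝ) h2
  have h3' : ((N ∪ ((Φ ∩ P) ∪ (Ω ∩ P))).card : ℝ) ≤ P.card := by exact_mod_cast h3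
  have h4' : ((N ∩ ((Φ ∩ P) ∪ (Ω ∩ P))).card : ℝ) ≤ (N ∩ Φ).card + (N ∩ Ω).card := by
    exact_mod_cast h4
  push_cast at h1' h2'
  by_contra hcon
  push Not at hcon
  nlinarith [hcon.1, hcon.2]

theorem meet (ε : ℝ) (P Ψ N N' : Finset ℕ) (hN : N ⊆ P) (hN' : N' ⊆ P)
    (cN : (1/3 + ε) * (P.card : ℝ) ≤ N.card)
    (cN' : (1/3 + ε) * (P.card : ℝ) ≤ N'.card)
    (cΨ : (1/3 + ε) * (P.card : ℝ) ≤ ((Ψ ∩ P).card : ℝ))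
    (d : ((N ∩ Ψ).card : ℝ) ≤ ε * P.card) (d' : ((N' ∩ Ψ).card : ℝ) ≤ ε * P.card) :
    ε * (P.card : ℝ) ≤ ((N ∩ N').card : ℝ) := by
  have h1 := Finset.card_union_add_card_inter N N'
  have h2 := Finset.card_union_add_card_inter (N ∪ N') (Ψ ∩ P)
  have h3 : ((N ∪ N') ∪ (Ψ ∩ P)).card ≤ P.card :=
    Finset.card_le_card (Finset.union_subset (Finset.union_subset hN hN')
      Finset.inter_subset_right)
  have h4 : ((N ∪ N') ∩ (Ψ ∩ P)).card ≤ (N ∩ Ψ).card + (N' ∩ Ψ).card := by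
    refine le_trans (Finset.card_le_card ?_) (Finset.card_union_le _ _)
    intro c hc
    simp only [Finset.mem_inter, Finset.mem_union] at hc ⊢
    tauto
  have h1' := congrArg (Nat.cast : ℕ → ℝ) h1
  have h2' := congrArg (Nat.cast : ℕ → ℝ) h2
  have h3' : (((N ∪ N') ∪ (Ψ ∩ P)).card : ℝ) ≤ P.card := by exact_mod_cast h3
  have h4' : (((N ∪ N') ∩ (Ψ ∩ P)).card : ℝ) ≤ (N ∩ Ψ).card + (N' ∩ Ψ).card := by
    exact_mod_cast h4
  push_cast at h1' h2'
  nlinarith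

theorem bip_colour (Z1 Z2 : Finset ℕ) (h1 : Z1.card = 2) (h2 : Z2.card = 3)
    (R B : ℕ → ℕ → Prop) (h : ∀ p ∈ Z1, ∀ q ∈ Z2, R p q ∨ B p q) :
    (∃ p ∈ Z1, ∃ p' ∈ Z1, ∃ q ∈ Z2, p ≠ p' ∧ R p q ∧ R p' q) ∨
    (∃ p ∈ Z1, ∃ q ∈ Z2, ∃ q' ∈ Z2, q ≠ q' ∧ B p q ∧ B p q') := by
  obtain ⟨p, p', hp, rfl⟩ := Finset.card_eq_two.1 h1
  obtain ⟨q, q', q'', hq, hq', hq'', rfl⟩ := Finset.card_eq_three.1 h2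
  by_contra hcon
  push Not at hcon
  obtain ⟨c1, c2⟩ := hcon
  have m1 : p ∈ ({p, p'} : Finset ℕ) := by simp
  have m2 : p' ∈ ({p, p'} : Finset ℕ) := by simp
  have n1 : q ∈ ({q, q', q''} : Finset ℕ) := by simp
  have n2 : q' ∈ ({q, q', q''} : Finset ℕ) := by simp
  have n3 : q'' ∈ ({q, q', q''} : Finset ℕ) := by simp
  have a1 := h p m1 q n1
  have a2 := h p m1 q' n2
  have a3 := h p m1 q'' n3
  have b1 := h p' m2 q n1
  have b2 := h p' m2 q' n2
  have b3 := h p' m2 q'' n3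
  have d1 := c1 p m1 p' m2 q n1 hp
  have d2 := c1 p m1 p' m2 q' n2 hp
  have d3 := c1 p m1 p' m2 q'' n3 hp
  have e1 := c2 p m1 q n1 q' n2 hq
  have e2 := c2 p m1 q n1 q'' n3 hq'
  have e3 := c2 p m1 q' n2 q'' n3 hq''
  have f1 := c2 p' m2 q n1 q' n2 hq
  have f2 := c2 p' m2 q n1 q'' n3 hq'
  have f3 := c2 p' m2 q' n2 q'' n3 hq''
  clear c1 c2 h
  grind

theorem two_meet {α : Type} (F : Finset ℕ) (E : ℕ → Finset α) (U : Finset α) (c : ℝ) (k : ℕ)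
    (hU : 0 < (U.card : ℝ)) (hk : k < F.card) (hkc : 1 ≤ (k : ℝ) * c) (hc : 0 < c)
    (hE : ∀ x ∈ F, E x ⊆ U) (hEc : ∀ x ∈ F, c * (U.card : ℝ) ≤ (E x).card) :
    ∃ x ∈ F, ∃ y ∈ F, x ≠ y ∧ ∃ t, t ∈ E x ∧ t ∈ E y := by
  by_contra hcon
  push Not at hcon
  have hdis : (F : Set ℕ).PairwiseDisjoint E := by
    intro x hx y hy hxy
    rw [Function.onFun, Finset.disjoint_left]
    exact fun t ht => hcon x hx y hy hxy t ht
  have h1 := Finset.card_biUnion hdis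
  have h2 : (F.biUnion E).card ≤ U.card := Finset.card_le_card (Finset.biUnion_subset.2 hE)
  rw [h1] at h2
  have h3 : ∑ x ∈ F, c * (U.card : ℝ) ≤ (U.card : ℝ) := by
    refine (Finset.sum_le_sum hEc).trans ?_
    exact_mod_cast h2
  rw [Finset.sum_const, nsmul_eq_mul] at h3
  have h4 : (k : ℝ) + 1 ≤ F.card := by exact_mod_cast hk
  have h5 : 0 < c * (U.card : ℝ) := by positivity
  nlinarith [mul_le_mul_of_nonneg_right h4 h5.le, mul_le_mul_of_nonneg_right hkc hU.le]

theorem no_bad (s : Finset (ℕ × ℕ)) (B : ℕ × ℕ → Prop) (c : ℝ) (hc : 0 ≤ c)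
    (h : ∀ p ∈ s, ¬ B p) : ((s.filter B).card : ℝ) ≤ c := by
  rw [Finset.filter_false_of_mem h]
  simpa using hc

set_option maxHeartbeats 4000000 in
theorem core (ε : ℝ) (hε : 0 < ε) (m M k : ℕ) (hk : 1 ≤ (k : ℝ) * ε ^ 3) (hm : 125 * k < m)
    (hM : 2 < ε ^ (m * m - m) * (M : ℝ)) (μ : ℝ) (hμ0 : 0 < μ) (hμ1 : μ ≤ ε ^ 3)
    (hμ2 : μ / ε ^ 3 * ((m * (M + M) : ℕ) : ℝ) ^ 2 < 1)
    (K : Finset ℕ) (hd : A.EEDense (1/3 + ε)) (hK : K ⊆ A.I) (hKc : m + (M + M) ≤ K.card)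
    (Φ Ψ Ω : Finset ℕ) (hΦ : A.IsHoleW μ (1/3 + ε) K Φ) (hΨ : A.IsHoleW μ (1/3 + ε) K Ψ)
    (hΩ : A.IsHoleW μ (1/3 + ε) K Ω) (hΦΨ : A.HolesIntersecting ε K Φ Ψ)
    (hΨΩ : A.HolesIntersecting ε K Ψ Ω) (hΦΩ : A.HolesDisjoint ε K Φ Ω) : A.SupportsK5 := by
  have hμ3 : ε ^ 3 ≤ 2 * ε ^ 3 - μ := by linarith
  -- split the index set
  obtain ⟨X, hXK, hXc⟩ := Finset.exists_subset_card_eq (show m ≤ K.card by omega)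
  have c1 : (K \ X).card = K.card - m := by rw [Finset.card_sdiff_of_subset hXK, hXc]
  obtain ⟨Y1, hY1, hY1c⟩ := Finset.exists_subset_card_eq (show M ≤ (K \ X).card by omega)
  have c2 : ((K \ X) \ Y1).card = K.card - m - M := by
    rw [Finset.card_sdiff_of_subset hY1, c1, hY1c]
  obtain ⟨Y2, hY2, hY2c⟩ := Finset.exists_subset_card_eq (show M ≤ ((K \ X) \ Y1).card by omega)
  have Y1K : ∀ y ∈ Y1, y ∈ K := fun y hy => (Finset.mem_sdiff.1 (hY1 hy)).1
  have Y1X : ∀ y ∈ Y1, y ∉ X := fun y hy => (Finset.mem_sdiff.1 (hY1 hy)).2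
  have Y2K : ∀ y ∈ Y2, y ∈ K := fun y hy =>
    (Finset.mem_sdiff.1 (Finset.mem_sdiff.1 (hY2 hy)).1).1
  have Y2X : ∀ y ∈ Y2, y ∉ X := fun y hy =>
    (Finset.mem_sdiff.1 (Finset.mem_sdiff.1 (hY2 hy)).1).2
  have Y2Y1 : ∀ y ∈ Y2, y ∉ Y1 := fun y hy => (Finset.mem_sdiff.1 (hY2 hy)).2
  have hMpos : 0 < M := by
    rcases Nat.eq_zero_or_pos M with h | h
    · subst h; simp at hM; linarith
    · exact h
  have hPne : ∀ i ∈ K, ∀ j ∈ K, i ≠ j → (A.P i j).Nonempty := fun i hi j hj hij =>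
    A.Pnonempty i j (hK hi) (hK hj) hij
  have hppos : ∀ i ∈ K, ∀ j ∈ K, i ≠ j → 0 < ((A.P i j).card : ℝ) := fun i hi j hj hij => by
    exact_mod_cast Finset.card_pos.2 (hPne i hi j hj hij)
  have Psw : ∀ i j, A.P i j = A.P j i := A.Psymm
  -- the sets to choose from
  set S : ℕ × ℕ → Finset ℕ := fun e =>
    if e.2 ∈ Y1 then Φ ∩ Ψ ∩ A.P e.1 e.2 else Ψ ∩ Ω ∩ A.P e.1 e.2 with hSdef
  have S1 : ∀ x y, y ∈ Y1 → S (x, y) = Φ ∩ Ψ ∩ A.P x y := fun x y hy => by simp [hSdef, hy]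
  have S2 : ∀ x y, y ∈ Y2 → S (x, y) = Ψ ∩ Ω ∩ A.P x y := fun x y hy => by
    simp [hSdef, Y2Y1 y hy]
  have YK : ∀ y ∈ Y1 ∪ Y2, y ∈ K := fun y hy => (Finset.mem_union.1 hy).elim (Y1K y) (Y2K y)
  have YX : ∀ y ∈ Y1 ∪ Y2, y ∉ X := fun y hy => (Finset.mem_union.1 hy).elim (Y1X y) (Y2X y)
  have xy : ∀ x ∈ X, ∀ y ∈ Y1 ∪ Y2, x ≠ y := fun x hx y hy h => YX y hy (h ▸ hx)
  have Sc : ∀ x ∈ X, ∀ y ∈ Y1 ∪ Y2, ε * ((A.P x y).card : ℝ) ≤ ((S (x, y)).card : ℝ) := by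
    intro x hx y hy
    rcases Finset.mem_union.1 hy with h | h
    · rw [S1 x y h]; exact hΦΨ x (hXK hx) y (YK y hy) (xy x hx y hy)
    · rw [S2 x y h]; exact hΨΩ x (hXK hx) y (YK y hy) (xy x hx y hy)
  have SP : ∀ x y, S (x, y) ⊆ A.P x y := by
    intro x y
    simp only [hSdef]
    split_ifs <;> exact Finset.inter_subset_right
  have SΨ : ∀ x y, S (x, y) ⊆ Ψ ∩ A.P x y := by
    intro x y c hc
    simp only [hSdef] at hc
    split_ifs at hc <;> simp only [Finset.mem_inter] at hc ⊢ <;> tauto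
  have SΦ : ∀ x, ∀ y ∈ Y1, S (x, y) ⊆ Φ ∩ A.P x y := by
    intro x y hy c hc
    rw [S1 x y hy] at hc
    simp only [Finset.mem_inter] at hc ⊢; tauto
  have SΩ : ∀ x, ∀ y ∈ Y2, S (x, y) ⊆ Ω ∩ A.P x y := by
    intro x y hy c hc
    rw [S2 x y hy] at hc
    simp only [Finset.mem_inter] at hc ⊢; tauto
  -- bad pairs
  set Bad : ℕ × ℕ → ℕ × ℕ → ℕ → ℕ → Prop := fun e e' u v =>
    (e.1 = e'.1 ∧ e.2 ∈ Y1 ∧ e'.2 ∈ Y1 ∧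
      ε * ((A.P e.2 e'.2).card : ℝ) < ((A.nbhd e.2 e'.2 u v ∩ Φ).card : ℝ)) ∨
    (e.1 = e'.1 ∧ e.2 ∈ Y2 ∧ e'.2 ∈ Y2 ∧
      ε * ((A.P e.2 e'.2).card : ℝ) < ((A.nbhd e.2 e'.2 u v ∩ Ω).card : ℝ)) ∨
    (e.1 ≠ e'.1 ∧ e.2 = e'.2 ∧
      ε * ((A.P e.1 e'.1).card : ℝ) < ((A.nbhd e.1 e'.1 u v ∩ Ψ).card : ℝ)) with hBadDef
  have hδ0 : 0 ≤ μ / ε ^ 3 := by positivity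
  obtain ⟨g, hg, hgb⟩ := select (X ×ˢ (Y1 ∪ Y2)) S
    (by
      rintro ⟨x, y⟩ he
      obtain ⟨hx, hy⟩ := Finset.mem_product.1 he
      have h1 := Sc x hx y hy
      have h2 := hppos x (hXK hx) y (YK y hy) (xy x hx y hy)
      have h3 : 0 < ((S (x, y)).card : ℝ) := lt_of_lt_of_le (by positivity) h1
      exact Finset.card_pos.1 (by exact_mod_cast h3))
    Bad (μ / ε ^ 3)
    (by
      have hdis : Disjoint Y1 Y2 := Finset.disjoint_right.2 Y2Y1
      rw [Finset.card_product, Finset.card_union_of_disjoint hdis, hXc, hY1c, hY2c]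
      exact hμ2) hδ0
    (by
      rintro ⟨x, y⟩ he ⟨x', y'⟩ he' hne
      obtain ⟨hx, hy⟩ := Finset.mem_product.1 he
      obtain ⟨hx', hy'⟩ := Finset.mem_product.1 he'
      dsimp only at hx hy hx' hy'
      by_cases hxx : x = x'
      · subst hxx
        have hyy : y ≠ y' := fun h => hne (by rw [h])
        by_cases h1 : y ∈ Y1 ∧ y' ∈ Y1
        · refine A.bad_cherries ε μ hε hμ0 Φ x y y' (hPne _ (YK y hy) _ (YK y' hy') hyy)
            (hΦ.1.2 x (hXK hx) y (YK y hy) y' (YK y' hy') (xy x hx y hy) (xy x hx y' hy') hyy)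
            _ _ (SΦ x y h1.1) (SΦ x y' h1.2) (Sc x hx y hy) (Sc x hx y' hy') _ ?_
          intro p hp
          rcases hp with hp | hp | hp
          · exact hp.2.2.2
          · exact absurd h1.1 (Y2Y1 _ hp.2.1)
          · exact absurd rfl hp.1
        · by_cases h2 : y ∈ Y2 ∧ y' ∈ Y2
          · refine A.bad_cherries ε μ hε hμ0 Ω x y y' (hPne _ (YK y hy) _ (YK y' hy') hyy)
              (hΩ.1.2 x (hXK hx) y (YK y hy) y' (YK y' hy') (xy x hx y hy) (xy x hx y' hy') hyy)
              _ _ (SΩ x y h2.1) (SΩ x y' h2.2) (Sc x hx y hy) (Sc x hx y' hy') _ ?_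
            intro p hp
            rcases hp with hp | hp | hp
            · exact absurd ⟨hp.2.1, hp.2.2.1⟩ h1
            · exact hp.2.2.2
            · exact absurd rfl hp.1
          · refine no_bad _ _ _ (by positivity) ?_
            · intro p _ hp
              rcases hp with hp | hp | hp
              · exact absurd ⟨hp.2.1, hp.2.2.1⟩ h1
              · exact absurd ⟨hp.2.1, hp.2.2.1⟩ h2
              · exact absurd rfl hp.1
      · by_cases hyy : y = y'
        · subst hyy
          have hole := hΨ.1.2 y (YK y hy) x (hXK hx) x' (hXK hx') (xy x hx y hy).symm
            (xy x' hx' y hy).symm hxx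
          have e1 := SΨ x y
          have e2 := SΨ x' y
          have e3 := Sc x hx y hy
          have e4 := Sc x' hx' y hy
          rw [Psw x y] at e1 e3
          rw [Psw x' y] at e2 e4
          refine A.bad_cherries ε μ hε hμ0 Ψ y x x' (hPne _ (hXK hx) _ (hXK hx') hxx)
            hole _ _ e1 e2 e3 e4 _ ?_
          intro p hp
          rcases hp with hp | hp | hp
          · exact absurd hp.1 hxx
          · exact absurd hp.1 hxx
          · exact hp.2.2
        · refine no_bad _ _ _ (by positivity) ?_
          · intro p _ hp
            rcases hp with hp | hp | hp
            · exact absurd hp.1 hxx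
            · exact absurd hp.1 hxx
            · exact absurd hp.2.1 hyy)
  have hgS : ∀ x ∈ X, ∀ y ∈ Y1 ∪ Y2, g (x, y) ∈ S (x, y) := fun x hx y hy =>
    hg (x, y) (Finset.mem_product.2 ⟨hx, hy⟩)
  have hgP : ∀ x ∈ X, ∀ y ∈ Y1 ∪ Y2, g (x, y) ∈ A.P x y := fun x hx y hy =>
    SP x y (hgS x hx y hy)
  have goodΦ : ∀ x ∈ X, ∀ y ∈ Y1, ∀ y' ∈ Y1, y ≠ y' →
      ((A.nbhd y y' (g (x, y)) (g (x, y')) ∩ Φ).card : ℝ) ≤ ε * ((A.P y y').card : ℝ) := by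
    intro x hx y hy y' hy' hne
    have := hgb (x, y) (Finset.mem_product.2 ⟨hx, Finset.mem_union_left _ hy⟩) (x, y')
      (Finset.mem_product.2 ⟨hx, Finset.mem_union_left _ hy'⟩) (fun h => hne (congrArg Prod.snd h))
    by_contra hcon
    exact this (Or.inl ⟨rfl, hy, hy', not_le.1 hcon⟩)
  have goodΩ : ∀ x ∈ X, ∀ y ∈ Y2, ∀ y' ∈ Y2, y ≠ y' →
      ((A.nbhd y y' (g (x, y)) (g (x, y')) ∩ Ω).card : ℝ) ≤ ε * ((A.P y y').card : ℝ) := by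
    intro x hx y hy y' hy' hne
    have := hgb (x, y) (Finset.mem_product.2 ⟨hx, Finset.mem_union_right _ hy⟩) (x, y')
      (Finset.mem_product.2 ⟨hx, Finset.mem_union_right _ hy'⟩)
      (fun h => hne (congrArg Prod.snd h))
    by_contra hcon
    exact this (Or.inr (Or.inl ⟨rfl, hy, hy', not_le.1 hcon⟩))
  have goodΨ : ∀ x ∈ X, ∀ x' ∈ X, x ≠ x' → ∀ y ∈ Y1 ∪ Y2,
      ((A.nbhd x x' (g (x, y)) (g (x', y)) ∩ Ψ).card : ℝ) ≤ ε * ((A.P x x').card : ℝ) := by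
    intro x hx x' hx' hne y hy
    have := hgb (x, y) (Finset.mem_product.2 ⟨hx, hy⟩) (x', y)
      (Finset.mem_product.2 ⟨hx', hy⟩) (fun h => hne (congrArg Prod.fst h))
    by_contra hcon
    exact this (Or.inr (Or.inr ⟨hne, rfl, not_le.1 hcon⟩))
  clear_value Bad
  clear hgb hBadDef Bad
  -- degree facts
  have degX : ∀ x ∈ X, ∀ x' ∈ X, x ≠ x' → ∀ y ∈ Y1 ∪ Y2, (1/3 + ε) * ((A.P x x').card : ℝ) ≤
      ((A.nbhd x x' (g (x, y)) (g (x', y))).card : ℝ) := by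
    intro x hx x' hx' hne y hy
    refine hd y x x' (hK (YK y hy)) (hK (hXK hx)) (hK (hXK hx')) (xy x hx y hy).symm
      (xy x' hx' y hy).symm hne _ ?_ _ ?_
    · rw [Psw]; exact hgP x hx y hy
    · rw [Psw]; exact hgP x' hx' y hy
  have degY : ∀ x ∈ X, ∀ y ∈ Y1 ∪ Y2, ∀ y' ∈ Y1 ∪ Y2, y ≠ y' →
      (1/3 + ε) * ((A.P y y').card : ℝ) ≤ ((A.nbhd y y' (g (x, y)) (g (x, y'))).card : ℝ) := by
    intro x hx y hy y' hy' hne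
    exact hd x y y' (hK (hXK hx)) (hK (YK y hy)) (hK (YK y' hy')) (xy x hx y hy)
      (xy x hx y' hy') hne _ (hgP x hx y hy) _ (hgP x hx y' hy')
  have nsub : ∀ i j u v, A.nbhd i j u v ⊆ A.P i j := fun i j u v => Finset.filter_subset _ _
  -- choose the vertices between indices in X
  obtain ⟨Z1', hZ1', Z2', hZ2', z1, z2, v, hv⟩ := popular_iter ε hε (fun s => A.P s.1 s.2)
    (fun s y => A.nbhd s.1 s.2 (g (s.1, y)) (g (s.2, y))) Y1 Y2
    (Finset.card_pos.1 (by omega)) (Finset.card_pos.1 (by omega)) X.offDiag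
    (by
      intro s hs
      obtain ⟨a, b, c⟩ := Finset.mem_offDiag.1 hs
      exact hPne _ (hXK a) _ (hXK b) c)
    (fun s _ y _ => nsub _ _ _ _)
    (by
      intro s hs y hy z hz
      obtain ⟨a, b, c⟩ := Finset.mem_offDiag.1 hs
      have hy' := Finset.mem_union_left Y2 hy
      have hz' := Finset.mem_union_right Y1 hz
      exact meet ε (A.P s.1 s.2) Ψ _ _ (nsub _ _ _ _) (nsub _ _ _ _)
        (degX _ a _ b c y hy') (degX _ a _ b c z hz') (hΨ.2 _ (hXK a) _ (hXK b) c)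
        (goodΨ _ a _ b c y hy') (goodΨ _ a _ b c z hz'))
  rw [Finset.offDiag_card, hXc, hY1c] at z1
  rw [Finset.offDiag_card, hXc, hY2c] at z2
  have z1' : 2 < Z1'.card := by exact_mod_cast lt_of_lt_of_le hM z1
  have z2' : 2 < Z2'.card := by exact_mod_cast lt_of_lt_of_le hM z2
  obtain ⟨Z1, hZ1, cZ1⟩ := Finset.exists_subset_card_eq (show 2 ≤ Z1'.card by omega)
  obtain ⟨Z2, hZ2, cZ2⟩ := Finset.exists_subset_card_eq (show 3 ≤ Z2'.card by omega)
  have ZY1 : ∀ y ∈ Z1, y ∈ Y1 := fun y hy => hZ1' (hZ1 hy)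
  have ZY2 : ∀ y ∈ Z2, y ∈ Y2 := fun y hy => hZ2' (hZ2 hy)
  have l1 : ∀ y ∈ Z1, y ∈ Y1 ∪ Y2 := fun y hy => Finset.mem_union_left _ (ZY1 y hy)
  have l2 : ∀ y ∈ Z2, y ∈ Y1 ∪ Y2 := fun y hy => Finset.mem_union_right _ (ZY2 y hy)
  have ZY : ∀ y ∈ Z1 ∪ Z2, y ∈ Y1 ∪ Y2 := fun y hy =>
    (Finset.mem_union.1 hy).elim (l1 y) (l2 y)
  have ZZ : ∀ y ∈ Z1 ∪ Z2, y ∈ Z1' ∪ Z2' := fun y hy => Finset.union_subset_union hZ1 hZ2 hy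
  have zne : ∀ p ∈ Z1, ∀ q ∈ Z2, p ≠ q := fun p hp q hq h =>
    Y2Y1 q (ZY2 q hq) (h ▸ ZY1 p hp)
  -- each link contains many edges on a triple
  have linkE : ∀ x ∈ X, ∃ T : ℕ × ℕ × ℕ, T ∈ (Z1 ∪ Z2) ×ˢ (Z1 ∪ Z2) ×ˢ (Z1 ∪ Z2) ∧
      (T.1 ≠ T.2.1 ∧ T.1 ≠ T.2.2 ∧ T.2.1 ≠ T.2.2) ∧
      ε ^ 3 * (((A.P T.1 T.2.1).card : ℝ) * ((A.P T.1 T.2.2).card : ℝ) *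
        ((A.P T.2.1 T.2.2).card : ℝ)) ≤
      A.ecount (A.nbhd T.1 T.2.1 (g (x, T.1)) (g (x, T.2.1)))
        (A.nbhd T.1 T.2.2 (g (x, T.1)) (g (x, T.2.2)))
        (A.nbhd T.2.1 T.2.2 (g (x, T.2.1)) (g (x, T.2.2))) := by
    intro x hx
    have hcol := bip_colour Z1 Z2 cZ1 cZ2
      (fun p q => ε * ((A.P p q).card : ℝ) ≤ ((A.nbhd p q (g (x, p)) (g (x, q)) ∩ Φ).card : ℝ))
      (fun p q => ε * ((A.P p q).card : ℝ) ≤ ((A.nbhd p q (g (x, p)) (g (x, q)) ∩ Ω).card : ℝ))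
      (fun p hp q hq => by
        have hpq := zne p hp q hq
        have hpK := YK p (l1 p hp)
        have hqK := YK q (l2 q hq)
        exact mixed ε (A.P p q) Φ Ω _ (nsub _ _ _ _) (degY x hx p (l1 p hp) q (l2 q hq) hpq)
          (hΦ.2 p hpK q hqK hpq) (hΩ.2 p hpK q hqK hpq) (hΦΩ p hpK q hqK hpq).le)
    have hfin : ∀ (H : Finset ℕ), A.IsHoleW μ (1/3 + ε) K H → ∀ i ∈ Z1 ∪ Z2, ∀ j ∈ Z1 ∪ Z2,
        ∀ k ∈ Z1 ∪ Z2, i ≠ j → i ≠ k → j ≠ k →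
        ε * ((A.P i j).card : ℝ) ≤ ((A.nbhd i j (g (x, i)) (g (x, j)) ∩ H).card : ℝ) →
        ε * ((A.P i k).card : ℝ) ≤ ((A.nbhd i k (g (x, i)) (g (x, k)) ∩ H).card : ℝ) →
        ((A.nbhd j k (g (x, j)) (g (x, k)) ∩ H).card : ℝ) ≤ ε * ((A.P j k).card : ℝ) →
        ε ^ 3 * (((A.P i j).card : ℝ) * ((A.P i k).card : ℝ) *
          ((A.P j k).card : ℝ)) ≤
        A.ecount (A.nbhd i j (g (x, i)) (g (x, j)))
          (A.nbhd i k (g (x, i)) (g (x, k)))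
          (A.nbhd j k (g (x, j)) (g (x, k))) := by
      intro H hH i hi j hj k hk hij hik hjk b1 b2 b3
      have iK := YK i (ZY i hi)
      have jK := YK j (ZY j hj)
      have kK := YK k (ZY k hk)
      have := A.link_edges ε μ hε H i j k (hH.1.2 i iK j jK k kK hij hik hjk)
        (hH.2 j jK k kK hjk) (hd i j k (hK iK) (hK jK) (hK kK) hij hik hjk)
        _ _ _ (nsub i j _ _) (nsub i k _ _) (nsub j k (g (x, j)) (g (x, k))) b1 b2
        (degY x hx j (ZY j hj) k (ZY k hk) hjk) b3
      refine le_trans ?_ this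
      refine mul_le_mul_of_nonneg_right hμ3 (by positivity)
    rcases hcol with ⟨p, hp, p', hp', q, hq, hpp, r1, r2⟩ | ⟨p, hp, q, hq, q', hq', hqq, r1, r2⟩
    · have u1 := Finset.mem_union_left Z2 hp
      have u2 := Finset.mem_union_left Z2 hp'
      have u3 := Finset.mem_union_right Z1 hq
      refine ⟨(q, p, p'), ?_, ⟨(zne p hp q hq).symm, (zne p' hp' q hq).symm, hpp⟩, ?_⟩
      · simp only [Finset.mem_product]; exact ⟨u3, u1, u2⟩
      · rw [A.nbhd_symm, Psw] at r1 r2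
        exact hfin Φ hΦ q u3 p u1 p' u2 (zne p hp q hq).symm (zne p' hp' q hq).symm hpp r1 r2
          (goodΦ x hx p (ZY1 p hp) p' (ZY1 p' hp') hpp)
    · have u1 := Finset.mem_union_left Z2 hp
      have u2 := Finset.mem_union_right Z1 hq
      have u3 := Finset.mem_union_right Z1 hq'
      refine ⟨(p, q, q'), ?_, ⟨zne p hp q hq, zne p hp q' hq', hqq⟩, ?_⟩
      · simp only [Finset.mem_product]; exact ⟨u1, u2, u3⟩
      · exact hfin Ω hΩ p u1 q u2 q' u3 (zne p hp q hq) (zne p hp q' hq') hqq r1 r2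
          (goodΩ x hx q (ZY2 q hq) q' (ZY2 q' hq') hqq)
  choose! T hTmem hTne hTe using linkE
  have cZ : (Z1 ∪ Z2).card = 5 := by
    rw [Finset.card_union_of_disjoint, cZ1, cZ2]
    rw [Finset.disjoint_left]
    exact fun p hp hq => zne p hp p hq rfl
  obtain ⟨T0, hT0, hfib⟩ := Finset.exists_lt_card_fiber_of_mul_lt_card_of_maps_to
    (s := X) (t := (Z1 ∪ Z2) ×ˢ (Z1 ∪ Z2) ×ˢ (Z1 ∪ Z2)) (f := T) (n := k) hTmem
    (by simp only [Finset.card_product, cZ, hXc]; omega)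
  obtain ⟨i, j, l⟩ := T0
  simp only [Finset.mem_product] at hT0
  obtain ⟨hi, hj, hl⟩ := hT0
  have hTx : ∀ x ∈ X.filter (fun x => T x = (i, j, l)), x ∈ X ∧ T x = (i, j, l) := fun x hx =>
    Finset.mem_filter.1 hx
  have hnee : i ≠ j ∧ i ≠ l ∧ j ≠ l := by
    obtain ⟨x, hx⟩ := Finset.card_pos.1 (show 0 < (X.filter (fun x => T x = (i, j, l))).card by
      omega)
    obtain ⟨hx1, hx2⟩ := hTx x hx
    have := hTne x hx1
    rw [hx2] at this
    exact this
  obtain ⟨hij, hil, hjl⟩ := hnee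
  have iK := YK i (ZY i hi)
  have jK := YK j (ZY j hj)
  have lK := YK l (ZY l hl)
  obtain ⟨x, hx, x', hx', hxx, t, ht, ht'⟩ := two_meet (X.filter (fun x => T x = (i, j, l)))
    (fun x => ((A.nbhd i j (g (x, i)) (g (x, j)) ×ˢ A.nbhd i l (g (x, i)) (g (x, l)) ×ˢ
      A.nbhd j l (g (x, j)) (g (x, l))).filter fun t => A.Edge t.1 t.2.1 t.2.2))
    (A.P i j ×ˢ A.P i l ×ˢ A.P j l) (ε ^ 3) k
    (by
      have h1 := hppos i iK j jK hij
      have h2 := hppos i iK l lK hil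
      have h3 := hppos j jK l lK hjl
      simp only [Finset.card_product]
      push_cast
      positivity) hfib hk (by positivity)
    (fun x _ => (Finset.filter_subset _ _).trans
      (Finset.product_subset_product (nsub _ _ _ _)
        (Finset.product_subset_product (nsub _ _ _ _) (nsub _ _ _ _))))
    (by
      intro x hx
      obtain ⟨hx1, hx2⟩ := hTx x hx
      have := hTe x hx1
      rw [hx2] at this
      simp only [Finset.card_product]
      push_cast
      rw [← mul_assoc ((A.P i j).card : ℝ)]
      exact this)
  have hxX := (hTx x hx).1
  have hxX' := (hTx x' hx').1
  simp only [Finset.mem_filter, Finset.mem_product, nbhd] at ht ht'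
  obtain ⟨hvP, hvN⟩ := hv (x, x') (Finset.mem_offDiag.2 ⟨hxX, hxX', hxx⟩)
  have hvE : ∀ y ∈ Z1 ∪ Z2, A.Edge (v (x, x')) (g (x, y)) (g (x', y)) := by
    intro y hy
    have := (Finset.mem_filter.1 (hvN y (ZZ y hy))).2
    exact A.EdgeSymm _ _ _ (A.EdgeSymm' _ _ _ this)
  have dx : ∀ y ∈ Z1 ∪ Z2, x ≠ y := fun y hy => xy x hxX y (ZY y hy)
  have dx' : ∀ y ∈ Z1 ∪ Z2, x' ≠ y := fun y hy => xy x' hxX' y (ZY y hy)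
  have px : ∀ y ∈ Z1 ∪ Z2, g (x, y) ∈ A.P x y := fun y hy => hgP x hxX y (ZY y hy)
  have px' : ∀ y ∈ Z1 ∪ Z2, g (x', y) ∈ A.P x' y := fun y hy => hgP x' hxX' y (ZY y hy)
  exact A.K5_of_values x x' i j l (hK (hXK hxX)) (hK (hXK hxX')) (hK iK) (hK jK) (hK lK)
    hxx (dx i hi) (dx j hj) (dx l hl) (dx' i hi) (dx' j hj) (dx' l hl) hij hil hjl
    (v (x, x')) (g (x, i)) (g (x, j)) (g (x, l)) (g (x', i)) (g (x', j)) (g (x', l))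
    t.1 t.2.1 t.2.2 hvP (px i hi) (px j hj) (px l hl) (px' i hi) (px' j hj) (px' l hl)
    ht.1.1.1 ht.1.2.1.1 ht.1.2.2.1 (hvE i hi) (hvE j hj) (hvE l hl)
    ht.1.1.2 ht.1.2.1.2 ht.1.2.2.2 ht'.1.1.2 ht'.1.2.1.2 ht'.1.2.2.2 ht.2

end ReducedHG

/-- Lemma 10 (`lem:transitivity`, transitivity lemma): for `(μ, 1/3+ε)`-holes in an
`ε`-wicked reduced hypergraph, the relation of being `ε`-intersecting is transitive
after passing to a large subset of the indices. -/
theorem transitivity_of_intersecting_holes :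
    ∀ ε : ℝ, 0 < ε → ∃ μ : ℝ, 0 < μ ∧ ∀ t : ℕ, ∃ s : ℕ,
      ∀ (A : ReducedHG) (J : Finset ℕ), A.Wicked ε → J ⊆ A.I → s ≤ J.card →
        ∀ Φ Ψ Ω : Finset ℕ,
          A.IsHoleW μ (1/3 + ε) J Φ → A.IsHoleW μ (1/3 + ε) J Ψ →
          A.IsHoleW μ (1/3 + ε) J Ω →
          A.HolesIntersecting ε J Φ Ψ → A.HolesIntersecting ε J Ψ Ω →
          ∃ Js ⊆ J, t ≤ Js.card ∧ A.HolesIntersecting ε Js Φ Ω := by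
  intro ε hε
  have hε3 : 0 < ε ^ 3 := by positivity
  obtain ⟨k, hk⟩ := exists_nat_ge (1 / ε ^ 3)
  have hk' : 1 ≤ (k : ℝ) * ε ^ 3 := by rwa [div_le_iff₀ hε3] at hk
  set m : ℕ := 125 * k + 1 with hm
  have hp : 0 < ε ^ (m * m - m) := by positivity
  obtain ⟨M, hM⟩ := exists_nat_gt (2 / ε ^ (m * m - m))
  have hM' : 2 < ε ^ (m * m - m) * (M : ℝ) := by
    rw [div_lt_iff₀ hp] at hM; linarith
  set q : ℝ := ((m * (M + M) : ℕ) : ℝ) ^ 2 with hq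
  have hq0 : 0 ≤ q := by positivity
  refine ⟨ε ^ 3 / (q + 1), by positivity, fun t => ?_⟩
  obtain ⟨s, hs⟩ := ReducedHG.ramsey_aux t (m + (M + M))
  refine ⟨s, fun A J hA hJ hsJ Φ Ψ Ω hΦ hΨ hΩ hΦΨ hΨΩ => ?_⟩
  have hmono : ∀ (K : Finset ℕ), K ⊆ J → ∀ H, A.IsHoleW (ε ^ 3 / (q + 1)) (1/3 + ε) J H →
      A.IsHoleW (ε ^ 3 / (q + 1)) (1/3 + ε) K H := by
    intro K hK H hH
    exact ⟨⟨fun i hi j hj => hH.1.1 i (hK hi) j (hK hj),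
      fun i hi j hj k hk => hH.1.2 i (hK hi) j (hK hj) k (hK hk)⟩,
      fun i hi j hj => hH.2 i (hK hi) j (hK hj)⟩
  rcases hs (fun i j => ε * ((A.P i j).card : ℝ) ≤ ((Φ ∩ Ω ∩ A.P i j).card : ℝ))
    (fun i j h => by rw [A.Psymm j i]; exact h) J hsJ with ⟨K, hKJ, hKc, hR⟩ | ⟨K, hKJ, hKc, hR⟩
  · exact ⟨K, hKJ, hKc, hR⟩
  · refine absurd ?_ hA.2
    refine A.core ε hε m M k hk' (by omega) hM' (ε ^ 3 / (q + 1)) (by positivity) ?_ ?_ K hA.1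
      (hKJ.trans hJ) hKc Φ Ψ Ω (hmono K hKJ Φ hΦ) (hmono K hKJ Ψ hΨ) (hmono K hKJ Ω hΩ)
      (fun i hi j hj => hΦΨ i (hKJ hi) j (hKJ hj)) (fun i hi j hj => hΨΩ i (hKJ hi) j (hKJ hj))
      (fun i hi j hj hij => not_le.1 (hR i hi j hj hij))
    · rw [div_le_iff₀ (by positivity)]; nlinarith
    · rw [← hq]
      have : ε ^ 3 / (q + 1) / ε ^ 3 * q = q / (q + 1) := by
        field_simp
      rw [this, div_lt_one (by positivity)]
      linarith
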